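/- Let f be an expanding Lorenz map with critical point c admitting a primary n(k)-cycle z_0 < ⋯ < z_{n-k-1} < c < z_{n-k} < ⋯ < z_{n-1}, and assume z_{k-1} ≠ f(0) and z_k ≠ f(1). Put u = f^{n-1}(0), v = f^{n-1}(1) and J = {x ∈ [0,1] : there is no m ≥ 0 with f^i(x) ≠ c for 0 ≤ i < m and f^m(x) ∈ (u,v)}. Then sup{x ∈ J : x < c} = z_{n-k-1} and inf{x ∈ J : x > c} = z_{n-k}, and moreover N((z_{n-k-1}, c)) = N((c, z_{n-k})) = n. -/

import Mathlib

open Set Filter Topology Function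

/-- `f` is an expanding Lorenz map on `[a,b]` with critical point `c`:
continuous and strictly increasing on `[a,c)` and `(c,b]`, with
`lim_{x→c⁻} f(x) = b`, `lim_{x→c⁺} f(x) = a`, and differentiable with
derivative uniformly greater than `1` outside a finite set. -/
structure IsExpandingLorenzOn (f : ℝ → ℝ) (c a b : ℝ) : Prop where
  a_lt_c : a < c
  c_lt_b : c < b
  mapsTo : Set.MapsTo f (Set.Icc a b) (Set.Icc a b)
  mono_left : StrictMonoOn f (Set.Ico a c)
  mono_right : StrictMonoOn f (Set.Ioc c b)
  cont_left : ContinuousOn f (Set.Ico a c)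
  cont_right : ContinuousOn f (Set.Ioc c b)
  lim_left : Filter.Tendsto f (nhdsWithin c (Set.Iio c)) (nhds b)
  lim_right : Filter.Tendsto f (nhdsWithin c (Set.Ioi c)) (nhds a)
  expanding : ∃ F : Set ℝ, F.Finite ∧ ∃ lam : ℝ, 1 < lam ∧
    ∀ x ∈ Set.Icc a b \ F, ∃ d : ℝ, HasDerivWithinAt f d (Set.Icc a b) x ∧ lam ≤ d

/-- An expanding Lorenz map on `[0,1]` with critical point `c`. -/
def IsExpandingLorenz (f : ℝ → ℝ) (c : ℝ) : Prop := IsExpandingLorenzOn f c 0 1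

/-- A primary `n(k)`-cycle `z 0 < z 1 < ⋯ < z (n-k-1) < c < z (n-k) < ⋯ < z (n-1)`
for a Lorenz map `f` with critical point `c`. -/
structure IsPrimaryCycle (f : ℝ → ℝ) (c : ℝ) (n k : ℕ) (z : ℕ → ℝ) : Prop where
  k_pos : 0 < k
  k_lt_n : k < n
  coprime : Nat.Coprime n k
  mem : ∀ i < n, z i ∈ Set.Icc (0:ℝ) 1
  mono : ∀ i j : ℕ, i < j → j < n → z i < z j
  left_of_c : ∀ i < n - k, z i < c
  right_of_c : ∀ i : ℕ, n - k ≤ i → i < n → c < z i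
  step : ∀ i < n, f (z i) = z ((i + k) % n)
  le_f0 : z (k - 1) ≤ f 0
  f1_le : f 1 ≤ z k

/-- `g` is a renormalization `(f^l, f^r)` of the Lorenz map `f` on the
renormalization interval `[u,v]`: on `[u,c)` (resp. `(c,v]`) the map `g`
is given by `f^[l]` (resp. `f^[r]`), with values given by one-sided limits
at points where some earlier iterate hits `c`, and `g` is itself an
expanding Lorenz map on `[u,v]` with critical point `c`. -/
structure IsRenormalization (f : ℝ → ℝ) (c : ℝ) (l r : ℕ) (u v : ℝ) (g : ℝ → ℝ) : Prop where
  one_lt_l : 1 < l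
  one_lt_r : 1 < r
  u_nonneg : 0 ≤ u
  u_lt_c : u < c
  c_lt_v : c < v
  v_le_one : v ≤ 1
  proper : 0 < u ∨ v < 1
  eq_left : ∀ x ∈ Set.Ico u c, (∀ i < l, f^[i] x ≠ c) → g x = f^[l] x
  eq_right : ∀ x ∈ Set.Ioc c v, (∀ i < r, f^[i] x ≠ c) → g x = f^[r] x
  lim_left_pt : ∀ x ∈ Set.Ico u c,
    Filter.Tendsto (f^[l]) (nhdsWithin x (Set.Ioi x)) (nhds (g x))
  lim_right_pt : ∀ x ∈ Set.Ioc c v,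
    Filter.Tendsto (f^[r]) (nhdsWithin x (Set.Iio x)) (nhds (g x))
  lim_c_left : Filter.Tendsto (f^[l]) (nhdsWithin c (Set.Iio c)) (nhds v)
  lim_c_right : Filter.Tendsto (f^[r]) (nhdsWithin c (Set.Ioi c)) (nhds u)
  lorenz : IsExpandingLorenzOn g c u v

/-- The forward orbit of `x` enters the set `S` with a `c`-free prefix:
there is `n ≥ 0` with `f^[i] x ≠ c` for `0 ≤ i < n` and `f^[n] x ∈ S`. -/
def CFreeEnters (f : ℝ → ℝ) (c : ℝ) (S : Set ℝ) (x : ℝ) : Prop :=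
  ∃ n : ℕ, (∀ i < n, f^[i] x ≠ c) ∧ f^[n] x ∈ S

/-- `N(U) = min {n ≥ 0 : f^[n] z = c for some z ∈ U}`. -/
noncomputable def hitTime (f : ℝ → ℝ) (c : ℝ) (U : Set ℝ) : ℕ :=
  sInf {n : ℕ | ∃ z ∈ U, f^[n] z = c}

/-- `x ∈ [0,1]` is a `c`-free periodic point of `f` of (exact) period `p`. -/
def IsCFreePeriodic (f : ℝ → ℝ) (c x : ℝ) (p : ℕ) : Prop :=
  x ∈ Set.Icc (0:ℝ) 1 ∧ f^[p] x = x ∧ (∀ i : ℕ, 0 < i → i < p → f^[i] x ≠ x) ∧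
    ∀ i < p, f^[i] x ≠ c

/-- Topological transitivity of `f` as a map of `[0,1]`. -/
def LorenzTransitive (f : ℝ → ℝ) : Prop :=
  ∀ U V : Set ℝ, IsOpen U → IsOpen V →
    (U ∩ Set.Icc 0 1).Nonempty → (V ∩ Set.Icc 0 1).Nonempty →
    ∃ n : ℕ, (f^[n] '' (U ∩ Set.Icc 0 1) ∩ (V ∩ Set.Icc 0 1)).Nonempty

/-- `f` is locally eventually onto: every nonempty (relatively) open subset of `[0,1]`
contains open intervals mapped homeomorphically onto `(0,c)` and onto `(c,1)`
by suitable iterates of `f`. -/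
def LocallyEventuallyOnto (f : ℝ → ℝ) (c : ℝ) : Prop :=
  ∀ U : Set ℝ, IsOpen U → (U ∩ Set.Icc 0 1).Nonempty →
    (∃ a b : ℝ, a < b ∧ Set.Ioo a b ⊆ U ∩ Set.Icc 0 1 ∧ ∃ n : ℕ,
      ContinuousOn (f^[n]) (Set.Ioo a b) ∧ Set.InjOn (f^[n]) (Set.Ioo a b) ∧
        f^[n] '' Set.Ioo a b = Set.Ioo 0 c) ∧
    (∃ a b : ℝ, a < b ∧ Set.Ioo a b ⊆ U ∩ Set.Icc 0 1 ∧ ∃ n : ℕ,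
      ContinuousOn (f^[n]) (Set.Ioo a b) ∧ Set.InjOn (f^[n]) (Set.Ioo a b) ∧
        f^[n] '' Set.Ioo a b = Set.Ioo c 1)

/-- The generalized backward orbit of `x`: points joined to `x` by a chain
following `f`, where at the critical point `c` the chain may continue with
either `0` or `1`. -/
def GenBackwardOrbit (f : ℝ → ℝ) (c x : ℝ) : Set ℝ :=
  {y | y ∈ Set.Icc (0:ℝ) 1 ∧ ∃ (k : ℕ) (w : ℕ → ℝ), w 0 = y ∧ w k = x ∧
    ∀ i < k, (w i ≠ c → w (i + 1) = f (w i)) ∧ (w i = c → w (i + 1) = 0 ∨ w (i + 1) = 1)}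
/-- A function with derivative at least `lam` on `(x, y)` off a finite set grows by at least
`lam * (y - x)`. -/
theorem mul_sub_le_of_hasDerivAt_off_finset {f : ℝ → ℝ} {lam : ℝ} (F : Finset ℝ) :
    ∀ x y : ℝ, x ≤ y → ContinuousOn f (Icc x y) →
      (∀ t ∈ Ioo x y, t ∉ F → ∃ d, HasDerivAt f d t ∧ lam ≤ d) →
      lam * (y - x) ≤ f y - f x := by
  induction F using Finset.induction_on with
  | empty =>
    intro x y hxy hc hd
    refine Convex.mul_sub_le_image_sub_of_le_deriv (convex_Icc x y) hc ?_ ?_ x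
      (left_mem_Icc.2 hxy) y (right_mem_Icc.2 hxy) hxy
    · intro t ht
      rw [interior_Icc] at ht
      obtain ⟨d, hd, -⟩ := hd t ht (by simp)
      exact hd.differentiableAt.differentiableWithinAt
    · intro t ht
      rw [interior_Icc] at ht
      obtain ⟨d, hd, hl⟩ := hd t ht (by simp)
      rwa [hd.deriv]
  | insert p F _ ih =>
    intro x y hxy hc hd
    by_cases hp : p ∈ Ioo x y
    · have h₁ := ih x p hp.1.le (hc.mono (Icc_subset_Icc_right hp.2.le)) fun t ht htF =>
        hd t ⟨ht.1, ht.2.trans hp.2⟩ (by simp [htF, ht.2.ne])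
      have h₂ := ih p y hp.2.le (hc.mono (Icc_subset_Icc_left hp.1.le)) fun t ht htF =>
        hd t ⟨hp.1.trans ht.1, ht.2⟩ (by simp [htF, ht.1.ne'])
      linarith
    · refine ih x y hxy hc fun t ht htF => hd t ht ?_
      have : t ≠ p := by rintro rfl; exact hp ht
      simp [htF, this]

/-- An expanding Lorenz map stretches distances by a uniform factor on each side of `c`. -/
theorem IsExpandingLorenz.exists_expansion {f : ℝ → ℝ} {c : ℝ} (hf : IsExpandingLorenz f c) :
    ∃ lam : ℝ, 1 < lam ∧ ∀ x y, x ≤ y → (0 ≤ x ∧ y < c ∨ c < x ∧ y ≤ 1) →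
      lam * (y - x) ≤ f y - f x := by
  obtain ⟨F, hF, lam, hlam, hd⟩ := hf.expanding
  refine ⟨lam, hlam, fun x y hxy h => ?_⟩
  have hc0 := hf.a_lt_c
  have hc1 := hf.c_lt_b
  have hx0 : 0 ≤ x := by rcases h with h | h <;> linarith [h.1]
  have hy1 : y ≤ 1 := by rcases h with h | h <;> linarith [h.2]
  refine mul_sub_le_of_hasDerivAt_off_finset hF.toFinset x y hxy ?_ fun t ht htF => ?_
  · rcases h with h | h
    · exact hf.cont_left.mono fun t ht => ⟨h.1.trans ht.1, ht.2.trans_lt h.2⟩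
    · exact hf.cont_right.mono fun t ht => ⟨h.1.trans_le ht.1, ht.2.trans h.2⟩
  · have h0t : 0 < t := hx0.trans_lt ht.1
    have ht1 : t < 1 := ht.2.trans_le hy1
    obtain ⟨d, hd, hl⟩ := hd t ⟨⟨h0t.le, ht1.le⟩, by simpa using htF⟩
    exact ⟨d, hd.hasDerivAt (Icc_mem_nhds h0t ht1), hl⟩

theorem IsExpandingLorenz.surjOn_left {f : ℝ → ℝ} {c a y : ℝ} (hf : IsExpandingLorenz f c)
    (ha0 : 0 ≤ a) (hac : a < c) (hy : y ∈ Ioo (f a) 1) : ∃ x ∈ Ioo a c, f x = y := by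
  obtain ⟨w, hwy, haw, hwc⟩ :=
    ((hf.lim_left.eventually (lt_mem_nhds hy.2)).and (Ioo_mem_nhdsLT hac)).exists
  obtain ⟨x, hx, rfl⟩ := intermediate_value_Ioo haw.le
    (hf.cont_left.mono fun t ht => ⟨ha0.trans ht.1, ht.2.trans_lt hwc⟩) ⟨hy.1, hwy⟩
  exact ⟨x, ⟨hx.1, hx.2.trans hwc⟩, rfl⟩

theorem IsExpandingLorenz.surjOn_right {f : ℝ → ℝ} {c b y : ℝ} (hf : IsExpandingLorenz f c)
    (hb1 : b ≤ 1) (hcb : c < b) (hy : y ∈ Ioo 0 (f b)) : ∃ x ∈ Ioo c b, f x = y := by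
  obtain ⟨w, hwy, hcw, hwb⟩ :=
    ((hf.lim_right.eventually (gt_mem_nhds hy.1)).and (Ioo_mem_nhdsGT hcb)).exists
  obtain ⟨x, hx, rfl⟩ := intermediate_value_Ioo hwb.le
    (hf.cont_right.mono fun t ht => ⟨hcw.trans_le ht.1, ht.2.trans hb1⟩) ⟨hwy, hy.2⟩
  exact ⟨x, ⟨hcw.trans hx.1, hx.2⟩, rfl⟩

theorem CFreeEnters.of_iterate {f : ℝ → ℝ} {c : ℝ} {T : Set ℝ} {n : ℕ} {x : ℝ}
    (hx : ∀ i < n, f^[i] x ≠ c) (h : CFreeEnters f c T (f^[n] x)) : CFreeEnters f c T x := by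
  obtain ⟨m, hm, hT⟩ := h
  refine ⟨m + n, fun i hi => ?_, by rwa [iterate_add_apply]⟩
  rcases lt_or_ge i n with h | h
  · exact hx i h
  · have := hm (i - n) (by omega)
    rwa [← iterate_add_apply, Nat.sub_add_cancel h] at this

/-- If `f^[n]` maps `E` into `E ∪ T` and multiplies a bounded positive function on `E` by at
least `lam > 1`, then orbits starting in `E` enter `T`. -/
theorem CFreeEnters.of_expansion {f : ℝ → ℝ} {c lam B : ℝ} {n : ℕ} {E T : Set ℝ} {P : ℝ → ℝ}
    (hlam : 1 < lam) (hfree : ∀ x ∈ E, ∀ i < n, f^[i] x ≠ c)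
    (hmap : ∀ x ∈ E, f^[n] x ∈ E ∪ T) (hexp : ∀ x ∈ E, lam * P x ≤ P (f^[n] x))
    (hpos : ∀ x ∈ E, 0 < P x) (hB : ∀ x ∈ E, P x ≤ B) {x : ℝ} (hx : x ∈ E) :
    CFreeEnters f c T x := by
  have key : ∀ j : ℕ, ∀ x ∈ E, B < lam ^ j * P x → CFreeEnters f c T x := by
    intro j
    induction j with
    | zero => intro x hx h; exact absurd (hB x hx) (by simpa using h)
    | succ j ih =>
      intro x hx h
      refine CFreeEnters.of_iterate (hfree x hx) ?_
      rcases hmap x hx with hE | hT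
      · refine ih _ hE (h.trans_le ?_)
        rw [pow_succ, mul_assoc]
        exact mul_le_mul_of_nonneg_left (hexp x hx) (by positivity)
      · exact ⟨0, by simp, hT⟩
  obtain ⟨j, hj⟩ := pow_unbounded_of_one_lt (B / P x) hlam
  exact key j x hx ((div_lt_iff₀ (hpos x hx)).1 hj)

theorem hitTime_eq {f : ℝ → ℝ} {c : ℝ} {U : Set ℝ} {n : ℕ} (hU : ∃ x ∈ U, f^[n] x = c)
    (hfree : ∀ x ∈ U, ∀ i < n, f^[i] x ≠ c) : hitTime f c U = n := by
  refine IsLeast.csInf_eq ⟨hU, ?_⟩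
  rintro m ⟨x, hx, hm⟩
  by_contra! h
  exact hfree x hx m h hm

namespace IsPrimaryCycle

variable {f : ℝ → ℝ} {c : ℝ} {n k : ℕ} {z : ℕ → ℝ}

theorem mono_le (hz : IsPrimaryCycle f c n k z) {i j : ℕ} (hij : i ≤ j) (hj : j < n) :
    z i ≤ z j := by
  rcases hij.eq_or_lt with rfl | h
  · exact le_rfl
  · exact (hz.mono i j h hj).le

theorem iterate_eq (hz : IsPrimaryCycle f c n k z) {j : ℕ} (hj : j < n) (m : ℕ) :
    ∃ i < n, f^[m] (z j) = z i := by
  induction m with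
  | zero => exact ⟨j, hj, rfl⟩
  | succ m ih =>
    obtain ⟨i, hi, h⟩ := ih
    exact ⟨(i + k) % n, Nat.mod_lt _ (by omega), by rw [iterate_succ_apply', h, hz.step i hi]⟩

theorem step_of_lt (hz : IsPrimaryCycle f c n k z) {i : ℕ} (hi : i + k < n) :
    f (z i) = z (i + k) := by
  rw [hz.step i (by omega), Nat.mod_eq_of_lt hi]

theorem step_of_ge (hz : IsPrimaryCycle f c n k z) {i : ℕ} (hi : i < n) (h : n ≤ i + k) :
    f (z i) = z (i + k - n) := by
  have := hz.k_lt_n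
  rw [hz.step i hi, Nat.mod_eq_sub_mod h, Nat.mod_eq_of_lt (by omega)]

theorem gap_index_ne (hz : IsPrimaryCycle f c n k z) {i : ℕ} (hi : i + 1 < n) :
    (k - 1 + k * i) % n + 1 < n := by
  have hk := hz.k_pos
  have hn := hz.k_lt_n
  have hlt : (k - 1 + k * i) % n < n := Nat.mod_lt _ (by omega)
  by_contra h
  have hm : (k - 1 + k * i) % n = n - 1 := by omega
  have hdiv := Nat.div_add_mod (k - 1 + k * i) n
  have hd : n ∣ k * (i + 1) :=
    ⟨(k - 1 + k * i) / n + 1, by rw [mul_add, mul_add]; omega⟩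
  have := Nat.le_of_dvd (by omega) (hz.coprime.dvd_of_dvd_mul_left hd)
  omega

theorem gap_index_ne_critical (hz : IsPrimaryCycle f c n k z) {i : ℕ} (hi : i + 2 < n) :
    (k - 1 + k * i) % n ≠ n - k - 1 := by
  have hk := hz.k_pos
  have hn := hz.k_lt_n
  intro hm
  have hdiv := Nat.div_add_mod (k - 1 + k * i) n
  have hd : n ∣ k * (i + 2) :=
    ⟨(k - 1 + k * i) / n + 1, by rw [mul_add, mul_add]; omega⟩
  have := Nat.le_of_dvd (by omega) (hz.coprime.dvd_of_dvd_mul_left hd)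
  omega

theorem gap_index_last (hz : IsPrimaryCycle f c n k z) :
    (k - 1 + k * (n - 2)) % n = n - k - 1 := by
  obtain ⟨j, rfl⟩ := Nat.exists_eq_add_of_lt hz.k_pos
  obtain ⟨N, rfl⟩ := Nat.exists_eq_add_of_lt hz.k_lt_n
  have : 0 + j + 1 - 1 + (0 + j + 1) * (0 + j + 1 + N + 1 - 2)
      = N + (0 + j + 1 + N + 1) * j := by
    have h : 0 + j + 1 + N + 1 - 2 = j + N := by omega
    rw [h, Nat.add_sub_cancel]
    ring
  rw [this, Nat.add_mul_mod_self_left, Nat.mod_eq_of_lt (by omega)]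
  omega

/-- A gap of the cycle other than the one around `c` lies on one side of `c`. -/
theorem gap_side (hz : IsPrimaryCycle f c n k z) {s : ℕ} (hs : s + 1 < n) (hne : s ≠ n - k - 1) :
    0 ≤ z s ∧ z (s + 1) < c ∨ c < z s ∧ z (s + 1) ≤ 1 := by
  rcases lt_or_ge s (n - k - 1) with h | h
  · exact .inl ⟨(hz.mem s (by omega)).1, hz.left_of_c _ (by omega)⟩
  · exact .inr ⟨hz.right_of_c _ (by omega) (by omega), (hz.mem _ hs).2⟩

theorem gap_step (hz : IsPrimaryCycle f c n k z) {s : ℕ} (hs : s + 1 < n) (hne : s ≠ n - k - 1)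
    (hs' : (s + k) % n + 1 < n) : f (z (s + 1)) = z ((s + k) % n + 1) := by
  have hn := hz.k_lt_n
  rcases lt_or_ge (s + k) n with h | h
  · rw [Nat.mod_eq_of_lt h, hz.step_of_lt (by omega)]
    congr 1; omega
  · rw [Nat.mod_eq_sub_mod h, Nat.mod_eq_of_lt (by omega), hz.step_of_ge hs (by omega)]
    congr 1; omega

/-- The iterates of `f` on the gap `[z (k-1), z k]`, up to its return to the gap around `c`. -/
theorem gap_iterate (hz : IsPrimaryCycle f c n k z) (hf : IsExpandingLorenz f c) {i : ℕ}
    (hi : i + 1 < n) :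
    f^[i] (z (k - 1)) = z ((k - 1 + k * i) % n) ∧
    f^[i] (z k) = z ((k - 1 + k * i) % n + 1) ∧
    ContinuousOn f^[i] (Icc (z (k - 1)) (z k)) ∧
    ∀ x ∈ Icc (z (k - 1)) (z k), ∀ y ∈ Icc (z (k - 1)) (z k), x ≤ y →
      y - x ≤ f^[i] y - f^[i] x := by
  have hk := hz.k_pos
  have hn := hz.k_lt_n
  obtain ⟨lam, hlam, hexp⟩ := hf.exists_expansion
  induction i with
  | zero =>
    have : (k - 1 + k * 0) % n = k - 1 := by simpa using Nat.mod_eq_of_lt (by omega)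
    rw [this, Nat.sub_add_cancel hk]
    exact ⟨rfl, rfl, continuousOn_id, fun x _ y _ _ => le_rfl⟩
  | succ i ih =>
    obtain ⟨h₁, h₂, h₃, h₄⟩ := ih (by omega)
    have hs := hz.gap_index_ne (i := i) (by omega)
    have hs' := hz.gap_index_ne hi
    have hne := hz.gap_index_ne_critical (i := i) (by omega)
    have hσ : (k - 1 + k * (i + 1)) % n = ((k - 1 + k * i) % n + k) % n := by
      rw [Nat.mod_add_mod, mul_add, mul_one, ← add_assoc]
    rw [hσ] at hs' ⊢
    generalize (k - 1 + k * i) % n = s at *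
    have hlr := (hz.mono (k - 1) k (by omega) hn).le
    have hmaps : MapsTo f^[i] (Icc (z (k - 1)) (z k)) (Icc (z s) (z (s + 1))) := by
      intro x hx
      have := h₄ _ (left_mem_Icc.2 hlr) x hx hx.1
      have := h₄ x hx _ (right_mem_Icc.2 hlr) hx.2
      constructor <;> linarith [hx.1, hx.2]
    have hside := hz.gap_side hs hne
    simp only [iterate_succ_apply']
    refine ⟨by rw [h₁, hz.step s (by omega)], by rw [h₂, hz.gap_step hs hne hs'], ?_, ?_⟩
    · rw [iterate_succ']
      refine ContinuousOn.comp ?_ h₃ hmaps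
      rcases hside with h | h
      · exact hf.cont_left.mono fun t ht => ⟨h.1.trans ht.1, ht.2.trans_lt h.2⟩
      · exact hf.cont_right.mono fun t ht => ⟨h.1.trans_le ht.1, ht.2.trans h.2⟩
    · intro x hx y hy hxy
      have h := h₄ x hx y hy hxy
      have hle : f^[i] x ≤ f^[i] y := by linarith
      have := hexp _ _ hle (hside.imp
        (fun h => ⟨h.1.trans (hmaps hx).1, (hmaps hy).2.trans_lt h.2⟩)
        (fun h => ⟨h.1.trans_le (hmaps hx).1, (hmaps hy).2.trans h.2⟩))
      nlinarith

theorem gap_iterate_ne (hz : IsPrimaryCycle f c n k z) (hf : IsExpandingLorenz f c) {i : ℕ}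
    (hi : i + 2 < n) {x : ℝ} (hx : x ∈ Icc (z (k - 1)) (z k)) : f^[i] x ≠ c := by
  obtain ⟨h₁, h₂, -, h₄⟩ := hz.gap_iterate hf (i := i) (by omega)
  have hlr := hx.1.trans hx.2
  have := h₄ _ (left_mem_Icc.2 hlr) x hx hx.1
  have := h₄ x hx _ (right_mem_Icc.2 hlr) hx.2
  rcases hz.gap_side (hz.gap_index_ne (by omega)) (hz.gap_index_ne_critical hi) with h | h
  · exact ne_of_lt (by linarith [h.2, hx.2])
  · exact ne_of_gt (by linarith [h.1, hx.1])

/-- If the first two iterates of `x` avoid `c` and the second lands in the gap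
`[z (k-1), z k]`, then `x, f x, …, f^[n-1] x` avoid `c`. -/
theorem iterate_ne_of_gap (hz : IsPrimaryCycle f c n k z) (hf : IsExpandingLorenz f c) {x : ℝ}
    (hx : x ≠ c) (hfx : f x ≠ c) (hffx : f (f x) ∈ Icc (z (k - 1)) (z k)) :
    ∀ i < n, f^[i] x ≠ c := by
  rintro (_ | _ | i) hi
  · exact hx
  · exact hfx
  · exact hz.gap_iterate_ne hf hi hffx

set_option maxHeartbeats 1000000 in
/-- The return to the gap around `c`, together with the position of `f^[n-1] 0` and
`f^[n-1] 1`. -/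
theorem return_map (hz : IsPrimaryCycle f c n k z) (hf : IsExpandingLorenz f c)
    (h0 : z (k - 1) ≠ f 0) (h1 : z k ≠ f 1) :
    ∃ lam : ℝ, 1 < lam ∧
      z (n - k - 1) < f^[n - 1] 0 ∧ f^[n - 1] 0 < c ∧ c < f^[n - 1] 1 ∧
      f^[n - 1] 1 < z (n - k) ∧
      (∀ x ∈ Ioo (z (n - k - 1)) c, (∀ i < n, f^[i] x ≠ c) ∧ f^[n] x < f^[n - 1] 1 ∧
        lam * (x - z (n - k - 1)) ≤ f^[n] x - z (n - k - 1)) ∧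
      (∀ x ∈ Ioo c (z (n - k)), (∀ i < n, f^[i] x ≠ c) ∧ f^[n - 1] 0 < f^[n] x ∧
        lam * (z (n - k) - x) ≤ z (n - k) - f^[n] x) ∧
      (∃ x ∈ Ioo (z (n - k - 1)) c, f^[n] x = c) ∧
      (∃ x ∈ Ioo c (z (n - k)), f^[n] x = c) := by
  have hk := hz.k_pos
  have hn := hz.k_lt_n
  obtain ⟨lam, hlam, hexp⟩ := hf.exists_expansion
  have hlam0 : 0 ≤ lam := by linarith
  obtain ⟨ha, hb, hcont, hh⟩ := hz.gap_iterate hf (i := n - 2) (by omega)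
  rw [hz.gap_index_last] at ha hb
  rw [show n - k - 1 + 1 = n - k by omega] at hb
  have hi₁ : ∀ x, f^[n - 1] x = f^[n - 2] (f x) := fun x => by
    rw [← iterate_succ_apply, show (n - 2).succ = n - 1 by omega]
  have hi₂ : ∀ x, f^[n] x = f^[n - 2] (f (f x)) := fun x => by
    rw [← hi₁, ← iterate_succ_apply, show (n - 1).succ = n by omega]
  rw [hi₁, hi₁]
  simp only [hi₂]
  have fa : f (z (n - k - 1)) = z (n - 1) := by
    rw [hz.step_of_lt (by omega)]; congr 1; omega
  have fb : f (z (n - k)) = z 0 := by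
    rw [hz.step_of_ge (by omega) (by omega)]; congr 1; omega
  have fl : f (z 0) = z k := by
    rw [hz.step_of_lt (by omega), Nat.zero_add]
  have fr : f (z (n - 1)) = z (k - 1) := by
    rw [hz.step_of_ge (by omega) (by omega)]; congr 1; omega
  have hac := hz.left_of_c (n - k - 1) (by omega)
  have hcb := hz.right_of_c (n - k) (by omega) (by omega)
  have hl := hz.left_of_c 0 (by omega)
  have hr := hz.right_of_c (n - 1) (by omega) (by omega)
  have ha0 := (hz.mem (n - k - 1) (by omega)).1
  have hb1 := (hz.mem (n - k) (by omega)).2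
  have hl0 := (hz.mem 0 (by omega)).1
  have hr1 := (hz.mem (n - 1) (by omega)).2
  have hf0 : z (k - 1) < f 0 := lt_of_le_of_ne hz.le_f0 h0
  have hf1 : f 1 < z k := lt_of_le_of_ne hz.f1_le (Ne.symm h1)
  have hlr : z (k - 1) ≤ z k := hz.mono_le (by omega) hn
  generalize f^[n - 2] = h at *
  generalize z (n - k - 1) = a at *
  generalize z (n - k) = b at *
  generalize z (n - 1) = r at *
  generalize hq : z (k - 1) = q at *
  generalize hp : z k = p at *
  generalize z 0 = l at *
  have hc0 : 0 < c := hf.a_lt_c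
  have hc1 : c < 1 := hf.c_lt_b
  have hql := left_mem_Icc.2 hlr
  have hpr := right_mem_Icc.2 hlr
  have hf01 : f 0 ≤ p := by
    have := hexp 0 l hl0 (.inl ⟨le_rfl, hl⟩)
    nlinarith
  have hf10 : q ≤ f 1 := by
    have := hexp r 1 hr1 (.inr ⟨hr, le_rfl⟩)
    nlinarith
  have hm0 : f 0 ∈ Icc q p := ⟨hf0.le, hf01⟩
  have hm1 : f 1 ∈ Icc q p := ⟨hf10, hf1.le⟩
  have left : ∀ x ∈ Ioo a c, r + lam * (x - a) ≤ f x ∧ f x < 1 ∧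
      q + lam * (x - a) ≤ f (f x) ∧ f (f x) < f 1 := by
    intro x hx
    have e₁ := hexp a x hx.1.le (.inl ⟨ha0, hx.2⟩)
    obtain ⟨y, hxy, hyc⟩ := exists_between hx.2
    have e₀ := hexp x y hxy.le (.inl ⟨ha0.trans hx.1.le, hyc⟩)
    have hy1 := (hf.mapsTo (x := y) ⟨ha0.trans (hx.1.trans hxy).le, hyc.le.trans hc1.le⟩).2
    have hx1 : f x < 1 := by nlinarith
    have hpos : 0 ≤ lam * (x - a) := mul_nonneg hlam0 (by linarith [hx.1])
    have hrx : r ≤ f x := by linarith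
    have e₂ := hexp r (f x) hrx (.inr ⟨hr, hx1.le⟩)
    have e₃ := hexp (f x) 1 hx1.le (.inr ⟨by linarith, le_rfl⟩)
    exact ⟨by linarith, hx1, by nlinarith, by nlinarith⟩
  have right : ∀ x ∈ Ioo c b, f x ≤ l - lam * (b - x) ∧ 0 < f x ∧
      f (f x) ≤ p - lam * (b - x) ∧ f 0 < f (f x) := by
    intro x hx
    have e₁ := hexp x b hx.2.le (.inr ⟨hx.1, hb1⟩)
    obtain ⟨y, hcy, hyx⟩ := exists_between hx.1
    have e₀ := hexp y x hyx.le (.inr ⟨hcy, hx.2.le.trans hb1⟩)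
    have hy0 := (hf.mapsTo (x := y) ⟨hc0.le.trans hcy.le, (hyx.trans hx.2).le.trans hb1⟩).1
    have hx0 : 0 < f x := by nlinarith
    have hpos : 0 ≤ lam * (b - x) := mul_nonneg hlam0 (by linarith [hx.2])
    have hxl : f x ≤ l := by linarith
    have e₂ := hexp (f x) l hxl (.inl ⟨hx0.le, hl⟩)
    have e₃ := hexp 0 (f x) hx0.le (.inl ⟨le_rfl, by linarith⟩)
    exact ⟨by linarith, hx0, by nlinarith, by nlinarith⟩
  have hgapL : ∀ x ∈ Ioo a c, f (f x) ∈ Icc q p := fun x hx => by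
    obtain ⟨-, -, h₃, h₄⟩ := left x hx
    exact ⟨by nlinarith [hx.1], by linarith⟩
  have hgapR : ∀ x ∈ Ioo c b, f (f x) ∈ Icc q p := fun x hx => by
    obtain ⟨-, -, h₃, h₄⟩ := right x hx
    exact ⟨by linarith, by nlinarith [hx.2]⟩
  have hr_big : c - a ≤ 1 - r := by
    have hlt : (c - a) / lam < c - a := div_lt_self (by linarith) hlam
    have hpos : 0 < (c - a) / lam := div_pos (by linarith) (by linarith)
    obtain ⟨h₁, h₂, -⟩ := left (a + (c - a) / lam) ⟨by linarith, by linarith⟩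
    rw [add_sub_cancel_left, mul_div_cancel₀ _ (by linarith)] at h₁
    linarith
  have hl_big : b - c ≤ l := by
    have hlt : (b - c) / lam < b - c := div_lt_self (by linarith) hlam
    have hpos : 0 < (b - c) / lam := div_pos (by linarith) (by linarith)
    obtain ⟨h₁, h₂, -⟩ := right (b - (b - c) / lam) ⟨by linarith, by linarith⟩
    rw [sub_sub_cancel, mul_div_cancel₀ _ (by linarith)] at h₁
    linarith
  have hv : c < h (f 1) := by
    have := hexp r 1 hr1 (.inr ⟨hr, le_rfl⟩)
    have := hh q hql (f 1) hm1 hf10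
    nlinarith
  have hu : h (f 0) < c := by
    have := hexp 0 l hl0 (.inl ⟨le_rfl, hl⟩)
    have := hh (f 0) hm0 p hpr hf01
    nlinarith
  refine ⟨lam, hlam, ?_, hu, hv, ?_, fun x hx => ⟨?_, ?_, ?_⟩, fun x hx => ⟨?_, ?_, ?_⟩, ?_, ?_⟩
  · linarith [hh q hql (f 0) hm0 hf0.le]
  · linarith [hh (f 1) hm1 p hpr hf1.le]
  · obtain ⟨h₁, -⟩ := left x hx
    refine hz.iterate_ne_of_gap hf hx.2.ne (ne_of_gt ?_) (by rw [hq, hp]; exact hgapL x hx)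
    nlinarith [hx.1]
  · obtain ⟨-, -, -, h₄⟩ := left x hx
    linarith [hh _ (hgapL x hx) _ hm1 h₄.le]
  · obtain ⟨-, -, h₃, -⟩ := left x hx
    linarith [hh q hql _ (hgapL x hx) (hgapL x hx).1]
  · obtain ⟨h₁, -⟩ := right x hx
    refine hz.iterate_ne_of_gap hf hx.1.ne' (ne_of_lt ?_) (by rw [hq, hp]; exact hgapR x hx)
    nlinarith [hx.2]
  · obtain ⟨-, -, -, h₄⟩ := right x hx
    linarith [hh _ hm0 _ (hgapR x hx) h₄.le]
  · obtain ⟨-, -, h₃, -⟩ := right x hx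
    linarith [hh _ (hgapR x hx) p hpr (hgapR x hx).2]
  · obtain ⟨w, hw, hwc⟩ := intermediate_value_Ioo hf10
      (hcont.mono (Icc_subset_Icc_right hf1.le)) ⟨by rwa [ha], hv⟩
    obtain ⟨y, hy, rfl⟩ := intermediate_value_Ioo hr1
      (hf.cont_right.mono fun t ht => ⟨hr.trans_le ht.1, ht.2⟩) ⟨by rw [fr]; exact hw.1, hw.2⟩
    obtain ⟨x, hx, rfl⟩ := hf.surjOn_left ha0 hac (by rwa [fa])
    exact ⟨x, hx, hwc⟩
  · obtain ⟨w, hw, hwc⟩ := intermediate_value_Ioo hf01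
      (hcont.mono (Icc_subset_Icc_left hf0.le)) ⟨hu, by rwa [hb]⟩
    obtain ⟨y, hy, rfl⟩ := intermediate_value_Ioo hl0
      (hf.cont_left.mono fun t ht => ⟨ht.1, ht.2.trans_lt hl⟩) ⟨hw.1, by rw [fl]; exact hw.2⟩
    obtain ⟨x, hx, rfl⟩ := hf.surjOn_right hb1 hcb (by rwa [fb])
    exact ⟨x, hx, hwc⟩

end IsPrimaryCycle

/-- for a primary `n(k)`-cycle with `z (k-1) ≠ f 0` and `z k ≠ f 1`,
`sup {x ∈ J : x < c} = z (n-k-1)`, `inf {x ∈ J : x > c} = z (n-k)` and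
`N((z (n-k-1), c)) = N((c, z (n-k))) = n`. -/
theorem primary_cycle_sup_inf_hitTime
    (f : ℝ → ℝ) (c : ℝ) (n k : ℕ) (z : ℕ → ℝ)
    (hf : IsExpandingLorenz f c) (hz : IsPrimaryCycle f c n k z)
    (h0 : z (k - 1) ≠ f 0) (h1 : z k ≠ f 1)
    (J : Set ℝ)
    (hJ : J = {x ∈ Set.Icc (0:ℝ) 1 | ∀ m : ℕ, (∀ i < m, f^[i] x ≠ c) →
      f^[m] x ∉ Set.Ioo (f^[n-1] (0:ℝ)) (f^[n-1] (1:ℝ))}) :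
    sSup {x ∈ J | x < c} = z (n - k - 1) ∧
    sInf {x ∈ J | c < x} = z (n - k) ∧
    hitTime f c (Set.Ioo (z (n - k - 1)) c) = n ∧
    hitTime f c (Set.Ioo c (z (n - k))) = n := by
  obtain ⟨lam, hlam, hau, huc, hcv, hvb, left, right, exL, exR⟩ := hz.return_map hf h0 h1
  have hk := hz.k_pos
  have hn := hz.k_lt_n
  have hcyc : ∀ j < n, z j ∈ J := by
    intro j hj
    rw [hJ]
    refine ⟨hz.mem j hj, fun m _ hm => ?_⟩
    obtain ⟨i, hi, he⟩ := hz.iterate_eq hj m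
    rw [he] at hm
    rcases lt_or_ge i (n - k) with h | h
    · linarith [hm.1, hz.mono_le (show i ≤ n - k - 1 by omega) (by omega)]
    · linarith [hm.2, hz.mono_le h hi]
  have hnot : ∀ x ∈ J, ¬ CFreeEnters f c (Ioo (f^[n - 1] 0) (f^[n - 1] 1)) x := by
    rintro x hx ⟨m, hm, hT⟩
    rw [hJ] at hx
    exact hx.2 m hm hT
  refine ⟨IsGreatest.csSup_eq ⟨⟨hcyc _ (by omega), hz.left_of_c _ (by omega)⟩, ?_⟩,
    IsLeast.csInf_eq ⟨⟨hcyc _ (by omega), hz.right_of_c _ (by omega) (by omega)⟩, ?_⟩,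
    hitTime_eq exL fun x hx => (left x hx).1, hitTime_eq exR fun x hx => (right x hx).1⟩
  · rintro x ⟨hxJ, hxc⟩
    by_contra! hax
    refine hnot x hxJ ?_
    rcases lt_or_ge (f^[n - 1] 0) x with h | h
    · exact ⟨0, by simp, h, hxc.trans hcv⟩
    have hE : ∀ y ∈ Ioc (z (n - k - 1)) (f^[n - 1] 0), y ∈ Ioo (z (n - k - 1)) c :=
      fun y hy => ⟨hy.1, hy.2.trans_lt huc⟩
    refine CFreeEnters.of_expansion (E := Ioc (z (n - k - 1)) (f^[n - 1] 0))
      (P := fun y => y - z (n - k - 1)) (B := f^[n - 1] 0 - z (n - k - 1)) hlam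
      (fun y hy => (left y (hE y hy)).1) (fun y hy => ?_) (fun y hy => (left y (hE y hy)).2.2)
      (fun y hy => sub_pos.2 hy.1) (fun y hy => sub_le_sub_right hy.2 _) ⟨hax, h⟩
    obtain ⟨-, h₂, h₃⟩ := left y (hE y hy)
    rcases lt_or_ge (f^[n - 1] 0) (f^[n] y) with h | h
    · exact .inr ⟨h, h₂⟩
    · exact .inl ⟨by nlinarith [hy.1], h⟩
  · rintro x ⟨hxJ, hcx⟩
    by_contra! hxb
    refine hnot x hxJ ?_
    rcases lt_or_ge x (f^[n - 1] 1) with h | h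
    · exact ⟨0, by simp, huc.trans hcx, h⟩
    have hE : ∀ y ∈ Ico (f^[n - 1] 1) (z (n - k)), y ∈ Ioo c (z (n - k)) :=
      fun y hy => ⟨hcv.trans_le hy.1, hy.2⟩
    refine CFreeEnters.of_expansion (E := Ico (f^[n - 1] 1) (z (n - k)))
      (P := fun y => z (n - k) - y) (B := z (n - k) - f^[n - 1] 1) hlam
      (fun y hy => (right y (hE y hy)).1) (fun y hy => ?_) (fun y hy => (right y (hE y hy)).2.2)
      (fun y hy => sub_pos.2 hy.2) (fun y hy => sub_le_sub_left hy.1 _) ⟨h, hxb⟩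
    obtain ⟨-, h₂, h₃⟩ := right y (hE y hy)
    rcases lt_or_ge (f^[n] y) (f^[n - 1] 1) with h | h
    · exact .inr ⟨h₂, h⟩
    · exact .inl ⟨h, by nlinarith [hy.2]⟩
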